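/- arXiv:1608.02923 — 2 statements merged into one kernel-verified Lean document; each statement's English description precedes it below -/
import Mathlib

section
/- (Tychonoff-type theorem for MV-topologies) If (⟨X_i, O_i⟩)_{i∈I} is a family of compact MV-topological spaces, then the product X = ∏_{i∈I} X_i, equipped with the product MV-topology, is a compact MV-topological space. -/
open Set

namespace MVTop

/-- Łukasiewicz truncated sum on the unit interval: `a ⊕ b = min (a + b) 1`. -/
noncomputable def mvAdd (a b : unitInterval) : unitInterval :=
  ⟨min (a.1 + b.1) 1, ⟨le_min (add_nonneg a.2.1 b.2.1) zero_le_one, min_le_right _ _⟩⟩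

/-- Łukasiewicz product on the unit interval: `a ⊙ b = max (a + b - 1) 0`. -/
noncomputable def mvMul (a b : unitInterval) : unitInterval :=
  ⟨max (a.1 + b.1 - 1) 0,
    ⟨le_max_right _ _, max_le (by nlinarith [a.2.1, a.2.2, b.2.1, b.2.2]) zero_le_one⟩⟩

variable {X Y : Type*}

/-- Pointwise truncated sum of fuzzy subsets. -/
noncomputable def fAdd (α β : X → unitInterval) : X → unitInterval := fun x => mvAdd (α x) (β x)

/-- Pointwise Łukasiewicz product of fuzzy subsets. -/
noncomputable def fMul (α β : X → unitInterval) : X → unitInterval := fun x => mvMul (α x) (β x)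

/-- Pointwise minimum of fuzzy subsets. -/
noncomputable def fInf (α β : X → unitInterval) : X → unitInterval := fun x => min (α x) (β x)

/-- Pointwise complement `α* = 1 - α`. -/
noncomputable def fStar (α : X → unitInterval) : X → unitInterval :=
  fun x => unitInterval.symm (α x)

instance : Fact ((0:ℝ) ≤ 1) := ⟨zero_le_one⟩

/-- Pointwise supremum of a family of fuzzy subsets. -/
noncomputable def fSup (Γ : Set (X → unitInterval)) : X → unitInterval :=
  fun x => ⨆ α ∈ Γ, α x

/-- The constant fuzzy subset `𝟏`. -/
noncomputable def fOne : X → unitInterval := fun _ => 1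

/-- The constant fuzzy subset `𝟎`. -/
noncomputable def fZero : X → unitInterval := fun _ => 0

/-- `fNsmul n α` is the `n`-fold truncated sum `α ⊕ ⋯ ⊕ α` (with `fNsmul 0 α = 𝟎`). -/
noncomputable def fNsmul : ℕ → (X → unitInterval) → (X → unitInterval)
  | 0, _ => fZero
  | n + 1, α => fAdd α (fNsmul n α)

/-- Truncated sum `f 0 ⊕ ⋯ ⊕ f (k-1)` of a finite family (empty sum is `𝟎`). -/
noncomputable def fSumFin : (k : ℕ) → (Fin k → (X → unitInterval)) → (X → unitInterval)
  | 0, _ => fZero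
  | k + 1, f => fAdd (f 0) (fSumFin k fun i => f i.succ)

/-- Łukasiewicz product `f 0 ⊙ ⋯ ⊙ f (k-1)` of a finite family (empty product is `𝟏`). -/
noncomputable def fMulFin : (k : ℕ) → (Fin k → (X → unitInterval)) → (X → unitInterval)
  | 0, _ => fOne
  | k + 1, f => fMul (f 0) (fMulFin k fun i => f i.succ)

/-- Pointwise minimum `f 0 ∧ ⋯ ∧ f (k-1)` of a finite family (empty infimum is `𝟏`). -/
noncomputable def fInfFin : (k : ℕ) → (Fin k → (X → unitInterval)) → (X → unitInterval)
  | 0, _ => fOne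
  | k + 1, f => fInf (f 0) (fInfFin k fun i => f i.succ)

/-- `O ⊆ [0,1]^X` is an MV-topology on `X`. -/
structure IsMVTopology (O : Set (X → unitInterval)) : Prop where
  zero_mem : fZero ∈ O
  one_mem : fOne ∈ O
  sSup_mem : ∀ Γ ⊆ O, fSup Γ ∈ O
  add_mem : ∀ o₁ ∈ O, ∀ o₂ ∈ O, fAdd o₁ o₂ ∈ O
  mul_mem : ∀ o₁ ∈ O, ∀ o₂ ∈ O, fMul o₁ o₂ ∈ O
  inf_mem : ∀ o₁ ∈ O, ∀ o₂ ∈ O, fInf o₁ o₂ ∈ O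

/-- Continuity of a map between MV-topological spaces. -/
def MVContinuous (O_X : Set (X → unitInterval)) (O_Y : Set (Y → unitInterval))
    (f : X → Y) : Prop :=
  ∀ α ∈ O_Y, (fun x => α (f x)) ∈ O_X

/-- `Γ` contains an additive covering: finitely many of its elements `α i` and positive
integers `n i` with `n 0 • α 0 ⊕ ⋯ ⊕ n (k-1) • α (k-1) = 𝟏`. -/
def ContainsAdditiveCover (Γ : Set (X → unitInterval)) : Prop :=
  ∃ (k : ℕ) (α : Fin k → X → unitInterval) (n : Fin k → ℕ),
    (∀ i, α i ∈ Γ) ∧ (∀ i, 0 < n i) ∧ fSumFin k (fun i => fNsmul (n i) (α i)) = fOne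

/-- Compactness: every open covering contains an additive covering. -/
def MVCompact (O : Set (X → unitInterval)) : Prop :=
  ∀ Γ ⊆ O, fSup Γ = fOne → ContainsAdditiveCover Γ

/-- The Hausdorff separation property for MV-topologies. -/
def MVHausdorff (O : Set (X → unitInterval)) : Prop :=
  ∀ x y : X, x ≠ y → ∃ ox ∈ O, ∃ oy ∈ O,
    ox x = 1 ∧ oy y = 1 ∧ fInf ox oy = fZero

/-- Zero-dimensionality: every open set is a supremum of clopen fuzzy subsets. -/
def MVZeroDim (O : Set (X → unitInterval)) : Prop :=
  ∀ o ∈ O, ∃ Γ : Set (X → unitInterval),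
    (∀ u ∈ Γ, u ∈ O ∧ fStar u ∈ O) ∧ fSup Γ = o

/-- `GenBase S` is the smallest set containing `S` and closed under `⊕`, `⊙`, `∧`
(the base `B_S` generated by a subbase `S`). -/
inductive GenBase (S : Set (X → unitInterval)) : (X → unitInterval) → Prop
  | base : ∀ α ∈ S, GenBase S α
  | add : ∀ α β, GenBase S α → GenBase S β → GenBase S (fAdd α β)
  | mul : ∀ α β, GenBase S α → GenBase S β → GenBase S (fMul α β)
  | inf : ∀ α β, GenBase S α → GenBase S β → GenBase S (fInf α β)

/-- `S` is a subbase for the MV-topology `O`. -/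
def IsSubbase (O S : Set (X → unitInterval)) : Prop :=
  S ⊆ O ∧ ∀ α ∈ O, ∃ Γ : Set (X → unitInterval),
    (∀ β ∈ Γ, GenBase S β) ∧ fSup Γ = α

/-- `S` is a large subbase for `O`: a subbase closed under the maps `α ↦ nα`, `n ≥ 1`. -/
def IsLargeSubbase (O S : Set (X → unitInterval)) : Prop :=
  IsSubbase O S ∧ ∀ α ∈ S, ∀ n : ℕ, 0 < n → fNsmul n α ∈ S

/-- `Θ` is a base for the MV-topology `O`. -/
def IsBase (O Θ : Set (X → unitInterval)) : Prop :=
  Θ ⊆ O ∧ ∀ α ∈ O, ∃ Γ ⊆ Θ, fSup Γ = α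

/-- The collection `𝔉` of open coverings of `X` containing no additive covering. -/
def MVF (O : Set (X → unitInterval)) : Set (Set (X → unitInterval)) :=
  {Γ | Γ ⊆ O ∧ fSup Γ = fOne ∧ ¬ ContainsAdditiveCover Γ}

/-- `M` is a maximal element of `𝔉` with respect to set inclusion. -/
def IsMaximalIn (M O : Set (X → unitInterval)) : Prop :=
  M ∈ MVF O ∧ ∀ Γ ∈ MVF O, M ⊆ Γ → Γ = M

variable {I : Type*} {Xf : I → Type*}

/-- The canonical subbase `S = {α ∘ π i : α ∈ O i, i ∈ I}` of the product MV-topology. -/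
def ProdSubbase (O : ∀ i, Set (Xf i → unitInterval)) :
    Set ((∀ i, Xf i) → unitInterval) :=
  {β | ∃ i, ∃ α ∈ O i, β = fun x => α (x i)}

/-- The product MV-topology: the smallest MV-topology containing `ProdSubbase O`. -/
def ProductMVTopology (O : ∀ i, Set (Xf i → unitInterval)) :
    Set ((∀ i, Xf i) → unitInterval) :=
  ⋂₀ {T | IsMVTopology T ∧ ProdSubbase O ⊆ T}


theorem coe_fNsmul (n : ℕ) (α : X → unitInterval) (x : X) :
    (fNsmul n α x : ℝ) = min (n * (α x : ℝ)) 1 := by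
  induction n with
  | zero => simp [fNsmul, fZero]
  | succ n ih =>
    change min ((α x : ℝ) + (fNsmul n α x : ℝ)) 1 = _
    rw [ih]
    have := (α x).2.1
    push_cast
    rcases le_total ((n : ℝ) * α x) 1 with h | h
    · rw [min_eq_left h]; congr 1; ring
    · rw [min_eq_right h, min_eq_right, min_eq_right] <;> linarith

theorem le_fSumFin {k : ℕ} (f : Fin k → X → unitInterval) (i : Fin k) (x : X) :
    f i x ≤ fSumFin k f x := by
  induction k with
  | zero => exact i.elim0
  | succ k ih =>
    rw [← Subtype.coe_le_coe]
    change (f i x : ℝ) ≤ min ((f 0 x : ℝ) + (fSumFin k (fun i => f i.succ) x : ℝ)) 1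
    refine le_min ?_ (f i x).2.2
    cases i using Fin.cases with
    | zero => exact le_add_of_nonneg_right (fSumFin k (fun i => f i.succ) x).2.1
    | succ i =>
      exact (Subtype.coe_le_coe.2 (ih (fun i => f i.succ) i)).trans
        (le_add_of_nonneg_left (f 0 x).2.1)

theorem fSumFin_eq_zero {k : ℕ} (f : Fin k → X → unitInterval) (x : X)
    (h : ∀ i, f i x = 0) : fSumFin k f x = 0 := by
  induction k with
  | zero => rfl
  | succ k ih =>
    apply Subtype.ext
    change min ((f 0 x : ℝ) + (fSumFin k (fun i => f i.succ) x : ℝ)) 1 = 0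
    simp [h 0, ih (fun i => f i.succ) fun i => h i.succ]

theorem fNsmul_eq_one {n : ℕ} {α : X → unitInterval} {x : X} (h : 1 ≤ n * (α x : ℝ)) :
    fNsmul n α x = 1 :=
  Subtype.ext <| by rw [coe_fNsmul, min_eq_right h]; rfl

theorem lt_fSup_iff {Γ : Set (X → unitInterval)} {x : X} {a : unitInterval} :
    a < fSup Γ x ↔ ∃ α ∈ Γ, a < α x := by
  simp [fSup, lt_iSup_iff]

theorem exists_dyadic_btwn {a b : ℝ} (ha : 0 ≤ a) (hab : a < b) :
    ∃ n k : ℕ, a ≤ (k : ℝ) / 2 ^ n ∧ (k : ℝ) / 2 ^ n < b := by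
  obtain ⟨n, hn⟩ := exists_pow_lt_of_lt_one (sub_pos.2 hab) (by norm_num : (1 / 2 : ℝ) < 1)
  have h2 : (0 : ℝ) < 2 ^ n := by positivity
  refine ⟨n, ⌈a * 2 ^ n⌉₊, (le_div_iff₀ h2).2 (Nat.le_ceil _), (div_lt_iff₀ h2).2 ?_⟩
  have h1 : (1 / 2 : ℝ) ^ n * 2 ^ n = 1 := by rw [← mul_pow]; norm_num
  have := Nat.ceil_lt_add_one (mul_nonneg ha h2.le)
  nlinarith

namespace IsMVTopology

variable {O : Set (X → unitInterval)}

theorem fNsmul_mem (hO : IsMVTopology O) {α : X → unitInterval} (hα : α ∈ O) (n : ℕ) :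
    fNsmul n α ∈ O := by
  induction n with
  | zero => exact hO.zero_mem
  | succ n ih => exact hO.add_mem _ hα _ ih

/-- The ordinary topology whose open sets are the supports of the members of `O`. -/
@[reducible]
def supportTopology (hO : IsMVTopology O) : TopologicalSpace X where
  IsOpen U := ∃ o ∈ O, U = {x | 0 < o x}
  isOpen_univ := ⟨fOne, hO.one_mem, by ext x; simp [fOne]⟩
  isOpen_inter := by
    rintro _ _ ⟨α, hα, rfl⟩ ⟨β, hβ, rfl⟩
    exact ⟨fInf α β, hO.inf_mem _ hα _ hβ, by
      ext x
      simp only [fInf, mem_inter_iff, mem_ofPred_eq, lt_min_iff]⟩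
  isOpen_sUnion := by
    intro S hS
    refine ⟨fSup {o | o ∈ O ∧ {x | 0 < o x} ∈ S}, hO.sSup_mem _ fun o ho => ho.1, ?_⟩
    ext x
    simp only [mem_sUnion, mem_ofPred_eq, lt_fSup_iff]
    constructor
    · rintro ⟨U, hU, hx⟩
      obtain ⟨o, ho, rfl⟩ := hS U hU
      exact ⟨o, ⟨ho, hU⟩, hx⟩
    · rintro ⟨o, ⟨-, hoS⟩, hx⟩
      exact ⟨_, hoS, hx⟩

theorem exists_support_eq_dyadic_lt (hO : IsMVTopology O) (n k : ℕ) (hk : k < 2 ^ n)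
    {α : X → unitInterval} (hα : α ∈ O) :
    ∃ o ∈ O, ∀ x, 0 < o x ↔ (k : ℝ) / 2 ^ n < α x := by
  induction n generalizing k α with
  | zero =>
    obtain rfl : k = 0 := by simpa using hk
    exact ⟨α, hα, fun x => by rw [Nat.cast_zero, zero_div]; exact Iff.rfl⟩
  | succ n ih =>
    have h2 : (0 : ℝ) < 2 ^ n := by positivity
    rcases lt_or_ge k (2 ^ n) with h | h
    · obtain ⟨o, ho, hox⟩ := ih k h (hO.add_mem _ hα _ hα)
      refine ⟨o, ho, fun x => (hox x).trans ?_⟩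
      change _ < min ((α x : ℝ) + α x) 1 ↔ _
      have hk1 : (k : ℝ) / 2 ^ n < 1 := by
        rw [div_lt_one h2]; exact_mod_cast h
      have hkk : (k : ℝ) / 2 ^ (n + 1) = k / 2 ^ n / 2 := by rw [pow_succ]; field_simp
      rw [lt_min_iff, hkk]
      exact ⟨fun h => by linarith [h.1], fun h => ⟨by linarith, hk1⟩⟩
    · obtain ⟨m, rfl⟩ := Nat.exists_eq_add_of_le h
      obtain ⟨o, ho, hox⟩ := ih m (by rw [pow_succ] at hk; omega) (hO.mul_mem _ hα _ hα)
      refine ⟨o, ho, fun x => (hox x).trans ?_⟩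
      change _ < max ((α x : ℝ) + α x - 1) 0 ↔ _
      have hm0 : 0 ≤ (m : ℝ) / 2 ^ n := by positivity
      have hkk : ((2 ^ n + m : ℕ) : ℝ) / 2 ^ (n + 1) = (1 + m / 2 ^ n) / 2 := by
        rw [pow_succ]; push_cast; field_simp
      rw [lt_max_iff, hkk]
      exact ⟨fun h => by rcases h with h | h <;> linarith, fun h => Or.inl (by linarith)⟩

theorem lowerSemicontinuous_of_mem (hO : IsMVTopology O) {α : X → unitInterval} (hα : α ∈ O) :
    @LowerSemicontinuous X _ hO.supportTopology _ α := by
  let := hO.supportTopology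
  intro x t ht
  obtain ⟨n, k, htk, hkx⟩ := exists_dyadic_btwn t.2.1 (Subtype.coe_lt_coe.2 ht)
  have hk : k < 2 ^ n := by
    have := (div_lt_one (by positivity)).1 (hkx.trans_le (α x).2.2)
    exact_mod_cast this
  obtain ⟨o, ho, hox⟩ := hO.exists_support_eq_dyadic_lt n k hk hα
  have hopen : IsOpen {y | 0 < o y} := ⟨o, ho, rfl⟩
  filter_upwards [hopen.mem_nhds ((hox x).2 hkx)] with y hy
  exact Subtype.coe_lt_coe.1 (htk.trans_lt ((hox y).1 hy))

theorem compactSpace_supportTopology (hO : IsMVTopology O) (hc : MVCompact O) :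
    @CompactSpace X hO.supportTopology := by
  let := hO.supportTopology
  refine ⟨isCompact_of_finite_subcover fun {ι} U hU hcov => ?_⟩
  choose o ho hoU using hU
  obtain ⟨k, α, n, hα, -, hsum⟩ := hc {β | ∃ i m, β = fNsmul m (o i)}
    (by rintro _ ⟨i, m, rfl⟩; exact hO.fNsmul_mem (ho i) m) (by
      ext1 x
      obtain ⟨i, hi⟩ := mem_iUnion.1 (hcov (mem_univ x))
      rw [hoU] at hi
      obtain ⟨m, hm⟩ := Archimedean.arch (1 : ℝ) (show (0 : ℝ) < o i x from hi)
      rw [nsmul_eq_mul] at hm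
      refine le_antisymm unitInterval.le_one' ?_
      rw [fOne, ← fNsmul_eq_one hm]
      exact le_iSup₂_of_le _ ⟨i, m, rfl⟩ le_rfl)
  choose i m him using hα
  classical
  refine ⟨Finset.univ.image i, fun x _ => ?_⟩
  by_contra hx
  have hzero : ∀ j, o (i j) x = 0 := fun j => by
    by_contra h
    refine hx (mem_iUnion₂.2 ⟨i j, by simp, ?_⟩)
    rw [hoU]
    exact unitInterval.pos_iff_ne_zero.2 h
  have h0 := fSumFin_eq_zero (fun j => fNsmul (n j) (α j)) x fun j => Subtype.ext <| by
    simp [coe_fNsmul, him, hzero]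
  rw [hsum] at h0
  exact one_ne_zero h0

end IsMVTopology

section LowerSemicontinuous

variable [TopologicalSpace X]

theorem lowerSemicontinuous_coe_iff {f : X → unitInterval} :
    LowerSemicontinuous (fun x => (f x : ℝ)) ↔ LowerSemicontinuous f :=
  ⟨fun h x t ht => h x t ht, fun h =>
    continuous_subtype_val.comp_lowerSemicontinuous h fun _ _ h => h⟩

theorem isMVTopology_lowerSemicontinuous :
    IsMVTopology {f : X → unitInterval | LowerSemicontinuous f} where
  zero_mem := lowerSemicontinuous_const
  one_mem := lowerSemicontinuous_const
  sSup_mem _ hΓ := lowerSemicontinuous_biSup fun _ hα => hΓ hα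
  add_mem _ hf _ hg := lowerSemicontinuous_coe_iff.1 <|
    ((lowerSemicontinuous_coe_iff.2 hf).add (lowerSemicontinuous_coe_iff.2 hg)).inf
      lowerSemicontinuous_const
  mul_mem _ hf _ hg := lowerSemicontinuous_coe_iff.1 <|
    (((lowerSemicontinuous_coe_iff.2 hf).add (lowerSemicontinuous_coe_iff.2 hg)).add
      (lowerSemicontinuous_const (z := (-1 : ℝ)))).sup lowerSemicontinuous_const
  inf_mem _ hf _ hg := hf.inf hg

theorem mvCompact_of_lowerSemicontinuous [CompactSpace X] {O : Set (X → unitInterval)}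
    (hO : ∀ f ∈ O, LowerSemicontinuous f) : MVCompact O := by
  intro Γ hΓ hcov
  let c : unitInterval := ⟨1 / 2, by norm_num, by norm_num⟩
  obtain ⟨t, ht⟩ := isCompact_univ.elim_finite_subcover
    (fun f : Γ => {x | c < f.1 x})
    (fun f => (hO _ (hΓ f.2)).isOpen_preimage c) (fun x _ => by
      have hx : c < fSup Γ x := by
        rw [hcov, ← Subtype.coe_lt_coe]; change (1 / 2 : ℝ) < 1; norm_num
      obtain ⟨f, hf, hfx⟩ := lt_fSup_iff.1 hx
      exact mem_iUnion.2 ⟨⟨f, hf⟩, hfx⟩)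
  refine ⟨t.card, fun j => (t.equivFin.symm j).1.1, fun _ => 2,
    fun j => (t.equivFin.symm j).1.2, fun _ => two_pos, ?_⟩
  ext1 x
  obtain ⟨f, hft, hfx⟩ := mem_iUnion₂.1 (ht (mem_univ x))
  have hfx' : (1 / 2 : ℝ) < f.1 x := hfx
  refine le_antisymm unitInterval.le_one' ?_
  have := le_fSumFin (fun j => fNsmul 2 (t.equivFin.symm j).1.1) (t.equivFin ⟨f, hft⟩) x
  rwa [Equiv.symm_apply_apply, fNsmul_eq_one (by push_cast; linarith)] at this

end LowerSemicontinuous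

theorem isMVTopology_sInter {𝒯 : Set (Set (X → unitInterval))}
    (h : ∀ T ∈ 𝒯, IsMVTopology T) : IsMVTopology (⋂₀ 𝒯) where
  zero_mem T hT := (h T hT).zero_mem
  one_mem T hT := (h T hT).one_mem
  sSup_mem Γ hΓ T hT := (h T hT).sSup_mem Γ fun _ hα => hΓ hα T hT
  add_mem _ h₁ _ h₂ T hT := (h T hT).add_mem _ (h₁ T hT) _ (h₂ T hT)
  mul_mem _ h₁ _ h₂ T hT := (h T hT).mul_mem _ (h₁ T hT) _ (h₂ T hT)
  inf_mem _ h₁ _ h₂ T hT := (h T hT).inf_mem _ (h₁ T hT) _ (h₂ T hT)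

/-- Tychonoff-type theorem for MV-topologies: the product of compact
MV-topological spaces is a compact MV-topological space. -/
theorem tychonoff_mv {I : Type*} {Xf : I → Type*}
    (O : ∀ i, Set (Xf i → unitInterval)) (hO : ∀ i, IsMVTopology (O i))
    (hc : ∀ i, MVCompact (O i)) :
    IsMVTopology (ProductMVTopology O) ∧ MVCompact (ProductMVTopology O) := by
  refine ⟨isMVTopology_sInter fun T hT => hT.1, ?_⟩
  let : ∀ i, TopologicalSpace (Xf i) := fun i => (hO i).supportTopology
  have : ∀ i, CompactSpace (Xf i) := fun i => (hO i).compactSpace_supportTopology (hc i)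
  refine mvCompact_of_lowerSemicontinuous fun f hf =>
    hf {f | LowerSemicontinuous f} ⟨isMVTopology_lowerSemicontinuous, ?_⟩
  rintro _ ⟨i, α, hα, rfl⟩
  exact LowerSemicontinuous.comp ((hO i).lowerSemicontinuous_of_mem hα) (continuous_apply i)

end MVTop
end

section
/- Let O be an MV-topology on a set X and let M be a maximal element, with respect to set inclusion, of the collection 𝔉 of open coverings of X containing no additive covering. If α, β ∈ O, α ∉ M, and α ≤ β pointwise, then β ∉ M. -/
open Set

namespace MVTop

variable {X Y : Type*}

variable {I : Type*} {Xf : I → Type*}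

theorem mvAdd_le_mvAdd {a b c d : unitInterval} (hab : a ≤ b) (hcd : c ≤ d) :
    mvAdd a c ≤ mvAdd b d :=
  Subtype.mk_le_mk.2 (min_le_min (add_le_add hab hcd) le_rfl)

theorem fNsmul_mono (n : ℕ) {α β : X → unitInterval} (h : α ≤ β) :
    fNsmul n α ≤ fNsmul n β := by
  induction n with
  | zero => exact le_rfl
  | succ n ih => exact fun x => mvAdd_le_mvAdd (h x) (ih x)

theorem fSumFin_mono {k : ℕ} {f g : Fin k → X → unitInterval} (h : f ≤ g) :
    fSumFin k f ≤ fSumFin k g := by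
  induction k with
  | zero => exact le_rfl
  | succ k ih => exact fun x => mvAdd_le_mvAdd (h 0 x) (ih (fun i => h i.succ) x)

theorem fSup_mono {Γ Δ : Set (X → unitInterval)} (h : Γ ⊆ Δ) : fSup Γ ≤ fSup Δ :=
  fun _ => biSup_mono h

theorem eq_fOne_of_fOne_le {γ : X → unitInterval} (h : fOne ≤ γ) : γ = fOne :=
  le_antisymm (fun _ => unitInterval.le_one') h

/-- An additive covering survives replacing each member by a larger one. -/
theorem ContainsAdditiveCover.of_forall_exists_le {Γ Δ : Set (X → unitInterval)}
    (hΓ : ContainsAdditiveCover Γ) (h : ∀ γ ∈ Γ, ∃ δ ∈ Δ, γ ≤ δ) :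
    ContainsAdditiveCover Δ := by
  obtain ⟨k, γ, n, hγ, hn, hsum⟩ := hΓ
  choose δ hδ hle using fun i => h (γ i) (hγ i)
  refine ⟨k, δ, n, hδ, hn, eq_fOne_of_fOne_le ?_⟩
  rw [← hsum]
  exact fSumFin_mono fun i => fNsmul_mono (n i) (hle i)

/-- for a maximal element `M` of `𝔉`, if `α, β ∈ O`, `α ∉ M`, and
`α ≤ β` pointwise, then `β ∉ M`. -/
theorem not_mem_maximal_of_le {X : Type*} (O : Set (X → unitInterval))
    (hO : IsMVTopology O) (M : Set (X → unitInterval)) (hM : IsMaximalIn M O)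
    (α β : X → unitInterval) (hα : α ∈ O) (hβ : β ∈ O)
    (hαM : α ∉ M) (hle : ∀ x, α x ≤ β x) : β ∉ M := by
  intro hβM
  obtain ⟨⟨hMO, hMcov, hMadd⟩, hmax⟩ := hM
  refine hαM (hmax (insert α M) ⟨insert_subset hα hMO, ?_, fun hc => hMadd ?_⟩
    (subset_insert α M) ▸ mem_insert α M)
  · exact eq_fOne_of_fOne_le (hMcov ▸ fSup_mono (subset_insert α M))
  · refine hc.of_forall_exists_le ?_
    rintro γ (rfl | hγ)
    exacts [⟨β, hβM, hle⟩, ⟨γ, hγ, le_rfl⟩]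

end MVTop
end
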